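/- The function ρ is even on [−π,π], ρ is smooth on the open interval (0,π), and for every λ > 0 there exists C_λ > 0 such that ρ'(θ) > C_λ θ^{−1/2} for all θ ∈ (0, π − λ). -/

import Mathlib

noncomputable section

open MeasureTheory

/-- Points of the Heisenberg group `ℍ`, identified with `ℝ³ ≅ ℂ × ℝ`:
`(x, y, t)` corresponds to `(z ; t)` with `z = x + iy`. -/
abbrev H : Type := ℝ × ℝ × ℝ

/-- The Heisenberg group law
`(x,y,t)·(x',y',t') = (x+x', y+y', t+t'+2(x'y − xy'))`. -/
def Hmul (p q : H) : H :=
  (p.1 + q.1, p.2.1 + q.2.1, p.2.2 + q.2.2 + 2 * (q.1 * p.2.1 - p.1 * q.2.1))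

/-- The Heisenberg group inverse. -/
def Hinv (p : H) : H := (-p.1, -p.2.1, -p.2.2)

/-- The identity `O = (0,0,0)`. -/
def HO : H := (0, 0, 0)

/-- The control (Carnot–Carathéodory) distance: the infimum of the lengths
`∫₀¹ √(a(s)² + b(s)²) ds` of horizontal Lipschitz curves `γ` joining `P` to `Q`,
i.e. curves satisfying a.e. `γ' = a·X(γ) + b·Y(γ)` where `X = ∂ₓ + 2y∂_t` and
`Y = ∂_y − 2x∂_t`. -/
def dH (P Q : H) : ℝ :=
  sInf { L : ℝ | ∃ (γ : ℝ → H) (a b : ℝ → ℝ) (K : NNReal),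
    LipschitzWith K γ ∧ γ 0 = P ∧ γ 1 = Q ∧
    (∀ᵐ s ∂volume, s ∈ Set.Icc (0:ℝ) 1 →
      HasDerivAt γ (a s, b s, 2 * (γ s).2.1 * a s - 2 * (γ s).1 * b s) s) ∧
    IntervalIntegrable (fun s => Real.sqrt (a s ^ 2 + b s ^ 2)) volume 0 1 ∧
    L = ∫ s in (0:ℝ)..1, Real.sqrt (a s ^ 2 + b s ^ 2) }

/-- `γ : ℝ → ℍ` is a `(1+ε)`-quasigeodesic. -/
def IsQuasiGeodesic (ε : ℝ) (γ : ℝ → H) : Prop :=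
  ∀ s s' : ℝ, (1 + ε)⁻¹ * |s - s'| ≤ dH (γ s) (γ s') ∧
    dH (γ s) (γ s') ≤ (1 + ε) * |s - s'|

/-- `f : ℍ → ℍ` is `(1+ε)`-biLipschitz for the control distance. -/
def IsBiLip (ε : ℝ) (f : H → H) : Prop :=
  ∀ P Q : H, (1 + ε)⁻¹ * dH P Q ≤ dH (f P) (f Q) ∧ dH (f P) (f Q) ≤ (1 + ε) * dH P Q

/-- `(a,b)` is the horizontal speed of `γ`: a.e. `γ'(s) = a(s)X(γ(s)) + b(s)Y(γ(s))`. -/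
def HasHorizSpeed (γ : ℝ → H) (a b : ℝ → ℝ) : Prop :=
  ∀ᵐ s ∂volume, HasDerivAt γ (a s, b s, 2 * (γ s).2.1 * a s - 2 * (γ s).1 * b s) s

/-- `ρ(θ) = d((1,0,0), (cos θ, sin θ, 0))`. -/
def rho (θ : ℝ) : ℝ := dH (1, 0, 0) (Real.cos θ, Real.sin θ, 0)

/-- primitive of the half circle function -/
def F1 (v : ℝ) : ℝ := ∫ u in (0:ℝ)..v, Real.sqrt (1 - u ^ 2)

lemma F1_deriv (v : ℝ) : HasDerivAt F1 (Real.sqrt (1 - v ^ 2)) v := by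
  have hc : Continuous (fun u : ℝ => Real.sqrt (1 - u ^ 2)) := by fun_prop
  exact intervalIntegral.integral_hasDerivAt_right (hc.intervalIntegrable _ _)
    (hc.stronglyMeasurableAtFilter _ _) hc.continuousAt

lemma F1_lip : LipschitzWith 1 F1 := by
  apply lipschitzWith_of_nnnorm_deriv_le (fun v => (F1_deriv v).differentiableAt)
  intro v
  rw [(F1_deriv v).deriv, ← NNReal.coe_le_coe, coe_nnnorm, Real.norm_eq_abs,
    abs_of_nonneg (Real.sqrt_nonneg _)]
  simp only [NNReal.coe_one]
  exact Real.sqrt_le_iff.2 ⟨zero_le_one, by nlinarith [sq_nonneg v]⟩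

lemma F1_diff : F1 1 - F1 (-1) = Real.pi / 2 := by
  have hc : Continuous (fun u : ℝ => Real.sqrt (1 - u ^ 2)) := by fun_prop
  rw [← integral_sqrt_one_sub_sq]
  unfold F1
  rw [intervalIntegral.integral_interval_sub_left (hc.intervalIntegrable _ _)
    (hc.intervalIntegrable _ _)]

lemma lip_ac {f : ℝ → ℝ} {K : NNReal} (h : LipschitzWith K f) (a b : ℝ) :
    AbsolutelyContinuousOnInterval f a b :=
  (h.lipschitzOnWith (s := Set.uIcc a b)).absolutelyContinuousOnInterval

lemma speed_int {x y : ℝ → ℝ} {K₁ K₂ : NNReal} (hx : LipschitzWith K₁ x) (hy : LipschitzWith K₂ y)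
    (a b : ℝ) :
    IntervalIntegrable (fun s => Real.sqrt (deriv x s ^ 2 + deriv y s ^ 2)) volume a b := by
  have h1 := (lip_ac hx a b).intervalIntegrable_deriv.norm
  have h2 := (lip_ac hy a b).intervalIntegrable_deriv.norm
  refine (h1.add h2).mono_fun ?_ ?_
  · apply Measurable.aestronglyMeasurable
    have := measurable_deriv x
    have := measurable_deriv y
    fun_prop
  · refine Filter.Eventually.of_forall fun s => ?_
    simp only [Real.norm_eq_abs]
    rw [abs_of_nonneg (Real.sqrt_nonneg _), abs_of_nonneg (by positivity)]
    apply Real.sqrt_le_iff.2 ⟨by positivity, ?_⟩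
    nlinarith [sq_abs (deriv x s), sq_abs (deriv y s), abs_nonneg (deriv x s),
      abs_nonneg (deriv y s), mul_nonneg (abs_nonneg (deriv x s)) (abs_nonneg (deriv y s))]

/-- calibration inequality on a piece -/
lemma piece {x y : ℝ → ℝ} {K₁ K₂ : NNReal} (hx : LipschitzWith K₁ x) (hy : LipschitzWith K₂ y)
    {c w : ℝ} (hw : 0 < w) {a b ε : ℝ} (hab : a ≤ b) (hε : ε ^ 2 = 1)
    (hX : ∀ s ∈ Set.Icc a b, ((x s - c) / w) ^ 2 ≤ 1) :
    (∫ s in a..b, ((x s - c) / w) * deriv y s) +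
      ε * w * (F1 ((x b - c) / w) - F1 ((x a - c) / w)) ≤
    ∫ s in a..b, Real.sqrt (deriv x s ^ 2 + deriv y s ^ 2) := by
  have hXl : LipschitzWith (Real.nnabs w⁻¹ * K₁) (fun s => (x s - c) / w) := by
    apply LipschitzWith.of_dist_le_mul
    intro p q
    have := hx.dist_le_mul p q
    rw [Real.dist_eq] at *
    have e : (x p - c) / w - (x q - c) / w = w⁻¹ * (x p - x q) := by field_simp; ring
    rw [e, abs_mul]
    push_cast
    rw [mul_assoc]
    exact mul_le_mul_of_nonneg_left this (abs_nonneg _)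
  have hFl : LipschitzWith (1 * (Real.nnabs w⁻¹ * K₁)) (fun s => F1 ((x s - c) / w)) :=
    F1_lip.comp hXl
  have hFTC := (lip_ac hFl a b).integral_deriv_eq_sub
  rw [← hFTC, ← intervalIntegral.integral_const_mul, ← intervalIntegral.integral_add]
  · apply intervalIntegral.integral_mono_ae_restrict hab
    · apply IntervalIntegrable.add
      · exact (lip_ac hy a b).intervalIntegrable_deriv.continuousOn_mul hXl.continuous.continuousOn
      · exact (lip_ac hFl a b).intervalIntegrable_deriv.const_mul _
    · exact speed_int hx hy a b
    · have h1 := hx.ae_differentiableAt_real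
      rw [Filter.EventuallyLE, ae_restrict_iff' measurableSet_Icc]
      filter_upwards [h1] with s hs hsab
      have hd : HasDerivAt (fun s => F1 ((x s - c) / w))
          (Real.sqrt (1 - ((x s - c) / w) ^ 2) * (deriv x s / w)) s := by
        exact (F1_deriv ((x s - c) / w)).comp s ((hs.hasDerivAt.sub_const c).div_const w)
      rw [hd.deriv]
      have hX' := hX s hsab
      set X := (x s - c) / w
      have e : ε * w * (Real.sqrt (1 - X ^ 2) * (deriv x s / w)) =
        ε * Real.sqrt (1 - X ^ 2) * deriv x s := by field_simp
      rw [e]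
      apply Real.le_sqrt_of_sq_le
      have hsq : Real.sqrt (1 - X ^ 2) ^ 2 = 1 - X ^ 2 := Real.sq_sqrt (by linarith)
      set q := Real.sqrt (1 - X ^ 2)
      have : deriv x s ^ 2 + deriv y s ^ 2 - (X * deriv y s + ε * q * deriv x s) ^ 2
        = (X * deriv x s - ε * q * deriv y s) ^ 2 := by
        linear_combination (-(deriv x s)^2 - (deriv y s)^2) * (q ^ 2 * hε + hsq)
      nlinarith [sq_nonneg (X * deriv x s - ε * q * deriv y s)]
  · exact (lip_ac hy a b).intervalIntegrable_deriv.continuousOn_mul hXl.continuous.continuousOn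
  · exact (lip_ac hFl a b).intervalIntegrable_deriv.const_mul _

lemma iso_pos {x y : ℝ → ℝ} {K₁ K₂ : NNReal} (hx : LipschitzWith K₁ x) (hy : LipschitzWith K₂ y)
    {T : ℝ} (hT : 0 ≤ T) (hx0 : x 0 = x T) (hy0 : y 0 = y T) {r : ℝ} (hr : 0 < r)
    (hA : ∫ s in (0:ℝ)..T, x s * deriv y s = Real.pi * r ^ 2) :
    2 * Real.pi * r ≤ ∫ s in (0:ℝ)..T, Real.sqrt (deriv x s ^ 2 + deriv y s ^ 2) := by
  have hne : (Set.Icc 0 T).Nonempty := ⟨0, by simp [hT]⟩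
  obtain ⟨s0, hs0, hmin⟩ := isCompact_Icc.exists_isMinOn hne hx.continuous.continuousOn
  obtain ⟨s1, hs1, hmax⟩ := isCompact_Icc.exists_isMaxOn hne hx.continuous.continuousOn
  rw [isMinOn_iff] at hmin
  rw [isMaxOn_iff] at hmax
  have hy' : ∀ a b, IntervalIntegrable (deriv y) volume a b := fun a b =>
    (lip_ac hy a b).intervalIntegrable_deriv
  have hxy' : ∀ a b, IntervalIntegrable (fun s => x s * deriv y s) volume a b := fun a b =>
    (hy' a b).continuousOn_mul hx.continuous.continuousOn
  have hyint : ∫ s in (0:ℝ)..T, deriv y s = 0 := by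
    rw [(lip_ac hy 0 T).integral_deriv_eq_sub, hy0, sub_self]
  set c := (x s0 + x s1) / 2 with hc
  set w := (x s1 - x s0) / 2 with hwdef
  have hw : 0 < w := by
    rcases (hmin s1 hs1).lt_or_eq with h | h
    · rw [hwdef]; linarith
    · exfalso
      have : ∫ s in (0:ℝ)..T, x s * deriv y s = ∫ s in (0:ℝ)..T, x s0 * deriv y s := by
        apply intervalIntegral.integral_congr
        intro s hs
        rw [Set.uIcc_of_le hT] at hs
        have : x s = x s0 := le_antisymm (h ▸ hmax s hs) (hmin s hs)
        simp only [this]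
      rw [this, intervalIntegral.integral_const_mul, hyint, mul_zero] at hA
      have : 0 < Real.pi * r ^ 2 := by positivity
      linarith
  have hX : ∀ s ∈ Set.Icc 0 T, ((x s - c) / w) ^ 2 ≤ 1 := by
    intro s hs
    rw [div_pow, div_le_one (by positivity)]
    have h1 := hmin s hs
    have h2 := hmax s hs
    apply sq_le_sq'
    · rw [hc, hwdef]; linarith
    · rw [hc, hwdef]; linarith
  have hX0 : (x s0 - c) / w = -1 := by
    rw [div_eq_iff hw.ne']; rw [hc, hwdef]; ring
  have hX1 : (x s1 - c) / w = 1 := by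
    rw [div_eq_iff hw.ne']; rw [hc, hwdef]; ring
  have hXy : ∀ a b, IntervalIntegrable (fun s => (x s - c) / w * deriv y s) volume a b :=
    fun a b => (hy' a b).continuousOn_mul
      ((hx.continuous.sub continuous_const).div_const w).continuousOn
  have hXA : ∫ s in (0:ℝ)..T, (x s - c) / w * deriv y s = Real.pi * r ^ 2 / w := by
    have : ∀ s, (x s - c) / w * deriv y s = w⁻¹ * (x s * deriv y s) - (c / w) * deriv y s := by
      intro s; field_simp
    simp_rw [this]
    rw [intervalIntegral.integral_sub ((hxy' _ _).const_mul _) ((hy' _ _).const_mul _),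
      intervalIntegral.integral_const_mul, intervalIntegral.integral_const_mul, hyint, hA]
    field_simp; simp
  have hsp := speed_int hx hy
  have hF := F1_diff
  have main : ∀ p q ε : ℝ, 0 ≤ p → p ≤ q → q ≤ T → ε ^ 2 = 1 →
      Real.pi * r ^ 2 / w + 2 * ε * w * (F1 ((x q - c) / w) - F1 ((x p - c) / w)) ≤
      ∫ s in (0:ℝ)..T, Real.sqrt (deriv x s ^ 2 + deriv y s ^ 2) := by
    intro p q ε h0 hpq hqT hε
    have i1 := piece hx hy hw (ε := -ε) h0 (by rw [neg_sq, hε])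
      (fun s hs => hX s ⟨hs.1, by linarith [hs.2]⟩)
    have i2 := piece hx hy hw (ε := ε) hpq hε
      (fun s hs => hX s ⟨by linarith [hs.1], by linarith [hs.2]⟩)
    have i3 := piece hx hy hw (ε := -ε) hqT (by rw [neg_sq, hε])
      (fun s hs => hX s ⟨by linarith [hs.1], by linarith [hs.2]⟩)
    rw [← hXA, ← intervalIntegral.integral_add_adjacent_intervals (hXy 0 p) (hXy p T),
      ← intervalIntegral.integral_add_adjacent_intervals (hXy p q) (hXy q T),
      ← intervalIntegral.integral_add_adjacent_intervals (hsp 0 p) (hsp p T),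
      ← intervalIntegral.integral_add_adjacent_intervals (hsp p q) (hsp q T)]
    rw [← hx0] at i3
    linarith
  have key : Real.pi * r ^ 2 / w + Real.pi * w ≤
      ∫ s in (0:ℝ)..T, Real.sqrt (deriv x s ^ 2 + deriv y s ^ 2) := by
    rcases le_total s0 s1 with h | h
    · have := main s0 s1 1 hs0.1 h hs1.2 (by norm_num)
      rw [hX0, hX1, hF] at this
      linarith
    · have := main s1 s0 (-1) hs1.1 h hs0.2 (by norm_num)
      rw [hX0, hX1] at this
      have e : F1 (-1) - F1 1 = - (Real.pi / 2) := by linarith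
      rw [e] at this
      linarith
  refine le_trans ?_ key
  rw [div_add' _ _ _ hw.ne', le_div_iff₀ hw]
  nlinarith [mul_nonneg Real.pi_pos.le (sq_nonneg (r - w))]

lemma iso {x y : ℝ → ℝ} {K₁ K₂ : NNReal} (hx : LipschitzWith K₁ x) (hy : LipschitzWith K₂ y)
    {T : ℝ} (hT : 0 ≤ T) (hx0 : x 0 = x T) (hy0 : y 0 = y T) {r : ℝ} (hr : 0 < r)
    (hA : ∫ s in (0:ℝ)..T, (x s * deriv y s - y s * deriv x s) = - (2 * Real.pi * r ^ 2)) :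
    2 * Real.pi * r ≤ ∫ s in (0:ℝ)..T, Real.sqrt (deriv x s ^ 2 + deriv y s ^ 2) := by
  have hy' : ∀ a b, IntervalIntegrable (fun s => x s * deriv y s) volume a b := fun a b =>
    (lip_ac hy a b).intervalIntegrable_deriv.continuousOn_mul hx.continuous.continuousOn
  have hx' : ∀ a b, IntervalIntegrable (fun s => y s * deriv x s) volume a b := fun a b =>
    (lip_ac hx a b).intervalIntegrable_deriv.continuousOn_mul hy.continuous.continuousOn
  rw [intervalIntegral.integral_sub (hy' _ _) (hx' _ _)] at hA
  have ibp := (lip_ac hx 0 T).integral_mul_deriv_eq_deriv_mul (lip_ac hy 0 T)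
  rw [hx0, hy0] at ibp
  have e : ∫ s in (0:ℝ)..T, deriv x s * y s = ∫ s in (0:ℝ)..T, y s * deriv x s := by
    congr 1; ext s; ring
  rw [e] at ibp
  have := iso_pos hy hx hT hy0 hx0 hr (by linarith)
  simpa only [add_comm] using this

def arcx (h m r p q s : ℝ) : ℝ := m * Real.cos h - r * Real.cos (h + (p + q * s))
def arcy (h m r p q s : ℝ) : ℝ := m * Real.sin h - r * Real.sin (h + (p + q * s))
def arct (m r p q s : ℝ) : ℝ := -2 * (r ^ 2 * (p + q * s) - m * r * Real.sin (p + q * s))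

lemma arc_ang (h p q s : ℝ) : HasDerivAt (fun s : ℝ => h + (p + q * s)) q s := by
  simpa using (((hasDerivAt_id s).const_mul q).const_add p).const_add h

lemma arcx_deriv (h m r p q s : ℝ) :
    HasDerivAt (arcx h m r p q) (q * (r * Real.sin (h + (p + q * s)))) s := by
  have := (((arc_ang h p q s).cos).const_mul r).const_sub (m * Real.cos h)
  exact this.congr_deriv (by ring)

lemma arcy_deriv (h m r p q s : ℝ) :
    HasDerivAt (arcy h m r p q) (-(q * (r * Real.cos (h + (p + q * s))))) s := by
  have := (((arc_ang h p q s).sin).const_mul r).const_sub (m * Real.sin h)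
  exact this.congr_deriv (by ring)

lemma arct_deriv (m r p q s : ℝ) :
    HasDerivAt (arct m r p q) (-2 * (q * (r ^ 2 - m * r * Real.cos (p + q * s)))) s := by
  have h1 := (arc_ang 0 p q s)
  simp only [zero_add] at h1
  have := ((h1.const_mul (r ^ 2)).sub ((h1.sin).const_mul (m * r))).const_mul (-2)
  exact this.congr_deriv (by ring)

lemma arc_cross (h m r p q s : ℝ) :
    arcx h m r p q s * (-(q * (r * Real.cos (h + (p + q * s))))) -
      arcy h m r p q s * (q * (r * Real.sin (h + (p + q * s)))) =
    q * (r ^ 2 - m * r * Real.cos (p + q * s)) := by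
  have e : Real.cos (p + q * s) = Real.cos (h + (p + q * s)) * Real.cos h
      + Real.sin (h + (p + q * s)) * Real.sin h := by
    rw [← Real.cos_sub]; congr 1; ring
  rw [e]
  unfold arcx arcy
  linear_combination (q * r ^ 2) * Real.sin_sq_add_cos_sq (h + (p + q * s))

lemma lip_of_bd {f f' : ℝ → ℝ} {B : ℝ} (hf : ∀ s, HasDerivAt f (f' s) s) (hB : ∀ s, |f' s| ≤ B) :
    LipschitzWith (Real.toNNReal B) f := by
  apply lipschitzWith_of_nnnorm_deriv_le (fun v => (hf v).differentiableAt)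
  intro v
  rw [(hf v).deriv, ← NNReal.coe_le_coe, coe_nnnorm, Real.norm_eq_abs]
  exact (hB v).trans (Real.le_coe_toNNReal B)

lemma arcx_lip (h m r p q : ℝ) : ∃ K, LipschitzWith K (arcx h m r p q) := by
  refine ⟨_, lip_of_bd (B := |q| * |r|) (arcx_deriv h m r p q) fun s => ?_⟩
  rw [abs_mul, abs_mul, ← mul_assoc]
  exact mul_le_of_le_one_right (by positivity) (Real.abs_sin_le_one _)

lemma arcy_lip (h m r p q : ℝ) : ∃ K, LipschitzWith K (arcy h m r p q) := by
  refine ⟨_, lip_of_bd (B := |q| * |r|) (arcy_deriv h m r p q) fun s => ?_⟩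
  rw [abs_neg, abs_mul, abs_mul, ← mul_assoc]
  exact mul_le_of_le_one_right (by positivity) (Real.abs_cos_le_one _)

lemma arct_lip (m r p q : ℝ) : ∃ K, LipschitzWith K (arct m r p q) := by
  refine ⟨_, lip_of_bd (B := 2 * (|q| * (r ^ 2 + |m * r|))) (arct_deriv m r p q) fun s => ?_⟩
  rw [abs_mul, abs_mul, abs_neg, abs_two]
  gcongr
  refine (abs_sub _ _).trans ?_
  rw [abs_of_nonneg (sq_nonneg r), abs_mul (m * r)]
  gcongr
  exact mul_le_of_le_one_right (by positivity) (Real.abs_cos_le_one _)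

lemma arc_speed (h r p q s : ℝ) :
    Real.sqrt ((q * (r * Real.sin (h + (p + q * s)))) ^ 2 +
      (-(q * (r * Real.cos (h + (p + q * s))))) ^ 2) = |q * r| := by
  rw [← Real.sqrt_sq_eq_abs]
  congr 1
  linear_combination (q * r) ^ 2 * Real.sin_sq_add_cos_sq (h + (p + q * s))

lemma glue_lip {f g : ℝ → ℝ} {K₁ K₂ : NNReal} (hf : LipschitzWith K₁ f) (hg : LipschitzWith K₂ g) :
    ∃ K, LipschitzWith K (fun s => f (min s 1) + (g (max s 1) - g 1)) :=
  ⟨_, (hf.comp (LipschitzWith.id.min_const 1)).add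
    ((hg.comp (LipschitzWith.id.max_const 1)).sub (LipschitzWith.const (g 1)))⟩

lemma glue_lt {f g : ℝ → ℝ} {s : ℝ} (hs : s < 1) :
    (fun s => f (min s 1) + (g (max s 1) - g 1)) s = f s ∧
    deriv (fun s => f (min s 1) + (g (max s 1) - g 1)) s = deriv f s := by
  constructor
  · simp [min_eq_left hs.le, max_eq_right hs.le]
  · apply Filter.EventuallyEq.deriv_eq
    filter_upwards [Iio_mem_nhds hs] with u hu
    rw [Set.mem_Iio] at hu
    simp [min_eq_left (le_of_lt hu), max_eq_right (le_of_lt hu)]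

lemma glue_gt {f g : ℝ → ℝ} (hfg : f 1 = g 1) {s : ℝ} (hs : 1 < s) :
    (fun s => f (min s 1) + (g (max s 1) - g 1)) s = g s ∧
    deriv (fun s => f (min s 1) + (g (max s 1) - g 1)) s = deriv g s := by
  constructor
  · simp [min_eq_right hs.le, max_eq_left hs.le, hfg]
  · apply Filter.EventuallyEq.deriv_eq
    filter_upwards [Ioi_mem_nhds hs] with u hu
    rw [Set.mem_Ioi] at hu
    simp [min_eq_right (le_of_lt hu), max_eq_left (le_of_lt hu), hfg]

/-- lower bound for the length of admissible curves -/
lemma lower {h m r φ : ℝ} (hr : 0 < r) (hφ : φ < Real.pi)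
    (e1 : r * Real.sin φ = Real.sin h) (e2 : m - r * Real.cos φ = Real.cos h)
    (e3 : φ * r ^ 2 = m * Real.sin h)
    {γ : ℝ → H} {a b : ℝ → ℝ} {K : NNReal} (hγ : LipschitzWith K γ)
    (h0 : γ 0 = (1, 0, 0)) (h1 : γ 1 = (Real.cos (2 * h), Real.sin (2 * h), 0))
    (hd : ∀ᵐ s ∂volume, s ∈ Set.Icc (0:ℝ) 1 →
      HasDerivAt γ (a s, b s, 2 * (γ s).2.1 * a s - 2 * (γ s).1 * b s) s) :
    2 * r * φ ≤ ∫ s in (0:ℝ)..1, Real.sqrt (a s ^ 2 + b s ^ 2) := by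
  have hx : LipschitzWith (1 * K) (fun s => (γ s).1) := LipschitzWith.prod_fst.comp hγ
  have hy : LipschitzWith (1 * (1 * K)) (fun s => (γ s).2.1) :=
    LipschitzWith.prod_fst.comp (LipschitzWith.prod_snd.comp hγ)
  have ht : LipschitzWith (1 * (1 * K)) (fun s => (γ s).2.2) :=
    LipschitzWith.prod_snd.comp (LipschitzWith.prod_snd.comp hγ)
  set x := fun s => (γ s).1 with hxdef
  set y := fun s => (γ s).2.1 with hydef
  set t := fun s => (γ s).2.2 with htdef
  have hd' : ∀ᵐ s ∂volume, s ∈ Set.Icc (0:ℝ) 1 → deriv x s = a s ∧ deriv y s = b s ∧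
      deriv t s = 2 * y s * a s - 2 * x s * b s := by
    filter_upwards [hd] with s hs hs'
    have := hs hs'
    have hf := this.hasFDerivAt
    exact ⟨hf.fst.hasDerivAt.deriv.trans (by simp), hf.snd.fst.hasDerivAt.deriv.trans (by simp),
      hf.snd.snd.hasDerivAt.deriv.trans (by simp [hxdef, hydef])⟩
  obtain ⟨p, q, hpq1, hpq2, hq⟩ : ∃ p q : ℝ, p + q * 1 = -φ ∧ p + q * 2 = φ - 2 * Real.pi ∧
      q = 2 * φ - 2 * Real.pi :=
    ⟨-φ - (2 * φ - 2 * Real.pi), _, by ring, by ring, rfl⟩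
  obtain ⟨K₁, hgx⟩ := arcx_lip h m r p q
  obtain ⟨K₂, hgy⟩ := arcy_lip h m r p q
  obtain ⟨K₃, hX⟩ := glue_lip hx hgx
  obtain ⟨K₄, hY⟩ := glue_lip hy hgy
  have c1x : x 1 = arcx h m r p q 1 := by
    simp only [hxdef, h1, arcx, hpq1]
    rw [Real.cos_add, Real.cos_neg, Real.sin_neg, Real.cos_two_mul]
    have := Real.sin_sq_add_cos_sq h
    linear_combination (-Real.cos h) * e2 + Real.sin h * e1 + this
  have c1y : y 1 = arcy h m r p q 1 := by
    simp only [hydef, h1, arcy, hpq1]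
    rw [Real.sin_add, Real.cos_neg, Real.sin_neg, Real.sin_two_mul]
    linear_combination (-Real.sin h) * e2 - Real.cos h * e1
  have c2x : arcx h m r p q 2 = 1 := by
    simp only [arcx, hpq2]
    rw [← add_sub_assoc, Real.cos_sub_two_pi, Real.cos_add]
    have := Real.sin_sq_add_cos_sq h
    linear_combination (Real.cos h) * e2 + Real.sin h * e1 + this
  have c2y : arcy h m r p q 2 = 0 := by
    simp only [arcy, hpq2]
    rw [← add_sub_assoc, Real.sin_sub_two_pi, Real.sin_add]
    linear_combination (Real.sin h) * e2 - Real.cos h * e1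
  set X := fun s => x (min s 1) + (arcx h m r p q (max s 1) - arcx h m r p q 1) with hXdef
  set Y := fun s => y (min s 1) + (arcy h m r p q (max s 1) - arcy h m r p q 1) with hYdef
  have hne1 : ∀ᵐ s ∂(volume : Measure ℝ), s ≠ 1 := by simp [ae_iff, measure_singleton]
  have L1 : ∫ s in (0:ℝ)..1, Real.sqrt (deriv X s ^ 2 + deriv Y s ^ 2) =
      ∫ s in (0:ℝ)..1, Real.sqrt (a s ^ 2 + b s ^ 2) := by
    apply intervalIntegral.integral_congr_ae
    filter_upwards [hd', hne1] with s hs hs1 hs2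
    rw [Set.uIoc_of_le zero_le_one] at hs2
    obtain ⟨q1, q2, q3⟩ := hs ⟨hs2.1.le, hs2.2⟩
    have hlt : s < 1 := lt_of_le_of_ne hs2.2 hs1
    rw [(glue_lt (f := x) hlt).2, (glue_lt (f := y) hlt).2, q1, q2]
  have A1 : ∫ s in (0:ℝ)..1, (X s * deriv Y s - Y s * deriv X s) = 0 := by
    have : ∫ s in (0:ℝ)..1, (X s * deriv Y s - Y s * deriv X s) =
        ∫ s in (0:ℝ)..1, (-1 / 2) * deriv t s := by
      apply intervalIntegral.integral_congr_ae
      filter_upwards [hd', hne1] with s hs hs1 hs2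
      rw [Set.uIoc_of_le zero_le_one] at hs2
      obtain ⟨q1, q2, q3⟩ := hs ⟨hs2.1.le, hs2.2⟩
      have hlt : s < 1 := lt_of_le_of_ne hs2.2 hs1
      rw [(glue_lt (f := x) hlt).2, (glue_lt (f := y) hlt).2, q1, q2, q3,
        show X s = x s from (glue_lt (f := x) hlt).1, show Y s = y s from (glue_lt (f := y) hlt).1]
      ring
    rw [this, intervalIntegral.integral_const_mul, (lip_ac ht 0 1).integral_deriv_eq_sub]
    simp [htdef, h0, h1]
  have L2 : ∫ s in (1:ℝ)..2, Real.sqrt (deriv X s ^ 2 + deriv Y s ^ 2) =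
      r * (2 * Real.pi - 2 * φ) := by
    have : ∫ s in (1:ℝ)..2, Real.sqrt (deriv X s ^ 2 + deriv Y s ^ 2) =
        ∫ s in (1:ℝ)..2, |q * r| := by
      apply intervalIntegral.integral_congr_ae
      filter_upwards with s hs2
      rw [Set.uIoc_of_le one_le_two] at hs2
      rw [(glue_gt c1x hs2.1).2, (glue_gt c1y hs2.1).2, (arcx_deriv h m r p q s).deriv,
        (arcy_deriv h m r p q s).deriv, arc_speed]
    rw [this, intervalIntegral.integral_const, abs_mul, abs_of_pos hr, hq, abs_of_neg (by linarith)]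
    simp only [smul_eq_mul]
    ring
  have A2 : ∫ s in (1:ℝ)..2, (X s * deriv Y s - Y s * deriv X s) = - (2 * Real.pi * r ^ 2) := by
    have : ∫ s in (1:ℝ)..2, (X s * deriv Y s - Y s * deriv X s) =
        ∫ s in (1:ℝ)..2, (-1 / 2) * deriv (arct m r p q) s := by
      apply intervalIntegral.integral_congr_ae
      filter_upwards with s hs2
      rw [Set.uIoc_of_le one_le_two] at hs2
      rw [(glue_gt c1x hs2.1).2, (glue_gt c1y hs2.1).2, (arcx_deriv h m r p q s).deriv,
        (arcy_deriv h m r p q s).deriv, show X s = _ from (glue_gt c1x hs2.1).1,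
        show Y s = _ from (glue_gt c1y hs2.1).1, arc_cross, (arct_deriv m r p q s).deriv]
      ring
    obtain ⟨K₅, hgt⟩ := arct_lip m r p q
    rw [this, intervalIntegral.integral_const_mul, (lip_ac hgt 1 2).integral_deriv_eq_sub]
    simp only [arct, hpq1, hpq2]
    rw [Real.sin_sub_two_pi, Real.sin_neg]
    linear_combination (-2 * m) * e1 + 2 * e3
  have hsp := speed_int hX hY
  have hcr : ∀ u v, IntervalIntegrable (fun s => X s * deriv Y s - Y s * deriv X s) volume u v :=
    fun u v => ((lip_ac hY u v).intervalIntegrable_deriv.continuousOn_mul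
        hX.continuous.continuousOn).sub
      ((lip_ac hX u v).intervalIntegrable_deriv.continuousOn_mul hY.continuous.continuousOn)
  have key := iso hX hY (T := 2) (by norm_num) (r := r)
    (by
      simp only [hXdef]
      norm_num
      rw [c2x, c1x]; simp [hxdef, h0])
    (by
      simp only [hYdef]
      norm_num
      rw [c2y, c1y]; simp [hydef, h0]) hr
    (by rw [← intervalIntegral.integral_add_adjacent_intervals (hcr 0 1) (hcr 1 2), A1, A2, zero_add])
  rw [← intervalIntegral.integral_add_adjacent_intervals (hsp 0 1) (hsp 1 2), L1, L2] at key
  linarith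

/-- the value of the distance -/
lemma dH_eq {h m r φ : ℝ} (hr : 0 < r) (hφ0 : 0 < φ) (hφ : φ < Real.pi)
    (e1 : r * Real.sin φ = Real.sin h) (e2 : m - r * Real.cos φ = Real.cos h)
    (e3 : φ * r ^ 2 = m * Real.sin h) :
    dH (1, 0, 0) (Real.cos (2 * h), Real.sin (2 * h), 0) = 2 * r * φ := by
  have hmem : ∃ (γ : ℝ → H) (a b : ℝ → ℝ) (K : NNReal),
    LipschitzWith K γ ∧ γ 0 = (1, 0, 0) ∧ γ 1 = (Real.cos (2 * h), Real.sin (2 * h), 0) ∧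
    (∀ᵐ s ∂volume, s ∈ Set.Icc (0:ℝ) 1 →
      HasDerivAt γ (a s, b s, 2 * (γ s).2.1 * a s - 2 * (γ s).1 * b s) s) ∧
    IntervalIntegrable (fun s => Real.sqrt (a s ^ 2 + b s ^ 2)) volume 0 1 ∧
    2 * r * φ = ∫ s in (0:ℝ)..1, Real.sqrt (a s ^ 2 + b s ^ 2) := by
    obtain ⟨q, hq⟩ : ∃ q : ℝ, q = -(2 * φ) := ⟨_, rfl⟩
    have hq1 : φ + q * 1 = -φ := by rw [hq]; ring
    have hq0 : φ + q * 0 = φ := by ring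
    obtain ⟨K₁, hgx⟩ := arcx_lip h m r φ q
    obtain ⟨K₂, hgy⟩ := arcy_lip h m r φ q
    obtain ⟨K₃, hgt⟩ := arct_lip m r φ q
    have hgt' : LipschitzWith (K₃ + 0) (fun s => arct m r φ q s - arct m r φ q 0) :=
      hgt.sub (LipschitzWith.const _)
    refine ⟨fun s => (arcx h m r φ q s, arcy h m r φ q s, arct m r φ q s - arct m r φ q 0),
      fun s => q * (r * Real.sin (h + (φ + q * s))),
      fun s => -(q * (r * Real.cos (h + (φ + q * s)))), _,
      hgx.prodMk (hgy.prodMk hgt'), ?_, ?_, ?_, ?_, ?_⟩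
    · simp only [arcx, arcy, hq0, sub_self]
      have := Real.sin_sq_add_cos_sq h
      rw [Real.cos_add, Real.sin_add]
      refine Prod.ext ?_ (Prod.ext ?_ rfl)
      · simp only
        linear_combination (Real.cos h) * e2 + Real.sin h * e1 + this
      · simp only
        linear_combination (Real.sin h) * e2 - Real.cos h * e1
    · simp only [arcx, arcy, arct, hq1, hq0]
      have := Real.sin_sq_add_cos_sq h
      rw [Real.cos_add, Real.sin_add, Real.cos_neg, Real.sin_neg, Real.cos_two_mul,
        Real.sin_two_mul]
      refine Prod.ext ?_ (Prod.ext ?_ ?_)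
      · simp only
        linear_combination (Real.cos h) * e2 - Real.sin h * e1 - this
      · simp only
        linear_combination (Real.sin h) * e2 + Real.cos h * e1
      · simp only
        linear_combination (-4 * m) * e1 + 4 * e3
    · refine Filter.Eventually.of_forall fun s _ => ?_
      refine (arcx_deriv h m r φ q s).prodMk ((arcy_deriv h m r φ q s).prodMk ?_)
      have := (arct_deriv m r φ q s).sub_const (arct m r φ q 0)
      convert this using 1
      have := arc_cross h m r φ q s
      simp only
      linear_combination (-2) * this
    · simp only [arc_speed]
      exact intervalIntegrable_const
    · simp only [arc_speed]
      rw [intervalIntegral.integral_const, abs_mul, abs_of_pos hr, hq, abs_of_neg (by linarith)]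
      simp only [smul_eq_mul]
      ring
  unfold dH
  apply le_antisymm
  · apply csInf_le
    · refine ⟨2 * r * φ, mem_lowerBounds.2 ?_⟩
      rintro L ⟨γ, a, b, K, g1, g2, g3, g4, g5, rfl⟩
      exact lower hr hφ e1 e2 e3 g1 g2 g3 g4
    · exact hmem
  · apply le_csInf
    · exact ⟨2 * r * φ, hmem⟩
    rintro L ⟨γ, a, b, K, g1, g2, g3, g4, g5, rfl⟩
    exact lower hr hφ e1 e2 e3 g1 g2 g3 g4

lemma even_mem {x y L : ℝ} (hL : ∃ (γ : ℝ → H) (a b : ℝ → ℝ) (K : NNReal),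
    LipschitzWith K γ ∧ γ 0 = (1, 0, 0) ∧ γ 1 = (x, y, 0) ∧
    (∀ᵐ s ∂volume, s ∈ Set.Icc (0:ℝ) 1 →
      HasDerivAt γ (a s, b s, 2 * (γ s).2.1 * a s - 2 * (γ s).1 * b s) s) ∧
    IntervalIntegrable (fun s => Real.sqrt (a s ^ 2 + b s ^ 2)) volume 0 1 ∧
    L = ∫ s in (0:ℝ)..1, Real.sqrt (a s ^ 2 + b s ^ 2)) :
    ∃ (γ : ℝ → H) (a b : ℝ → ℝ) (K : NNReal),
    LipschitzWith K γ ∧ γ 0 = (1, 0, 0) ∧ γ 1 = (x, -y, 0) ∧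
    (∀ᵐ s ∂volume, s ∈ Set.Icc (0:ℝ) 1 →
      HasDerivAt γ (a s, b s, 2 * (γ s).2.1 * a s - 2 * (γ s).1 * b s) s) ∧
    IntervalIntegrable (fun s => Real.sqrt (a s ^ 2 + b s ^ 2)) volume 0 1 ∧
    L = ∫ s in (0:ℝ)..1, Real.sqrt (a s ^ 2 + b s ^ 2) := by
  obtain ⟨γ, a, b, K, g1, g2, g3, g4, g5, g6⟩ := hL
  have hx : LipschitzWith (1 * K) (fun s => (γ s).1) := LipschitzWith.prod_fst.comp g1
  have hy : LipschitzWith (1 * (1 * K)) (fun s => (γ s).2.1) :=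
    LipschitzWith.prod_fst.comp (LipschitzWith.prod_snd.comp g1)
  have ht : LipschitzWith (1 * (1 * K)) (fun s => (γ s).2.2) :=
    LipschitzWith.prod_snd.comp (LipschitzWith.prod_snd.comp g1)
  refine ⟨fun s => ((γ s).1, -(γ s).2.1, -(γ s).2.2), a, fun s => - b s, _,
    hx.prodMk (hy.neg.prodMk ht.neg), ?_, ?_, ?_, ?_, ?_⟩
  · simp [g2]
  · simp [g3]
  · filter_upwards [g4] with s hs hs'
    have hf := (hs hs').hasFDerivAt
    have d1 : HasDerivAt (fun s => (γ s).1) (a s) s :=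
      hf.fst.hasDerivAt.congr_deriv (by simp)
    have d2 : HasDerivAt (fun s => (γ s).2.1) (b s) s :=
      hf.snd.fst.hasDerivAt.congr_deriv (by simp)
    have d3 : HasDerivAt (fun s => (γ s).2.2) (2 * (γ s).2.1 * a s - 2 * (γ s).1 * b s) s :=
      hf.snd.snd.hasDerivAt.congr_deriv (by simp)
    refine d1.prodMk (d2.neg.prodMk (d3.neg.congr_deriv ?_))
    ring
  · simpa using g5
  · simpa using g6

lemma rho_even (θ : ℝ) : rho (-θ) = rho θ := by
  unfold rho dH
  rw [Real.cos_neg, Real.sin_neg]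
  congr 1
  ext L
  constructor
  · intro h
    have := even_mem h
    rw [neg_neg] at this
    exact this
  · exact even_mem

lemma mul_cos_lt_sin {φ : ℝ} (h0 : 0 < φ) (h1 : φ < Real.pi) : φ * Real.cos φ < Real.sin φ := by
  have hs := Real.sin_pos_of_pos_of_lt_pi h0 h1
  rcases lt_or_ge φ (Real.pi / 2) with h | h
  · have hc := Real.cos_pos_of_mem_Ioo ⟨by linarith, h⟩
    have := Real.lt_tan h0 h
    rwa [Real.tan_eq_sin_div_cos, lt_div_iff₀ hc] at this
  · have := Real.cos_nonpos_of_pi_div_two_le_of_le h (by linarith)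
    nlinarith

lemma D_pos {φ : ℝ} (h0 : 0 < φ) : 0 < φ - Real.sin φ * Real.cos φ := by
  have := Real.sin_lt (x := 2 * φ) (by linarith)
  rw [Real.sin_two_mul] at this
  linarith

lemma phi_exists (h : ℝ) : ∃ φ : ℝ, h ∈ Set.Ioo 0 (Real.pi / 2) →
    Real.pi / 2 - h < φ ∧ φ < Real.pi - h ∧ φ * Real.sin h = Real.sin φ * Real.sin (φ + h) := by
  by_cases hh : h ∈ Set.Ioo 0 (Real.pi / 2)
  swap
  · exact ⟨0, fun H => absurd H hh⟩
  obtain ⟨h0, h1⟩ := hh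
  have hpi := Real.pi_pos
  have hs := Real.sin_pos_of_pos_of_lt_pi h0 (by linarith)
  have hc : ContinuousOn (fun φ => φ * Real.sin h - Real.sin φ * Real.sin (φ + h))
    (Set.Icc (Real.pi / 2 - h) (Real.pi - h)) := by fun_prop
  have := intermediate_value_Ioo (by linarith) hc
  have h0' : (0:ℝ) ∈ Set.Ioo ((Real.pi / 2 - h) * Real.sin h -
      Real.sin (Real.pi / 2 - h) * Real.sin (Real.pi / 2 - h + h))
      ((Real.pi - h) * Real.sin h - Real.sin (Real.pi - h) * Real.sin (Real.pi - h + h)) := by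
    constructor
    · have := mul_cos_lt_sin (φ := Real.pi / 2 - h) (by linarith) (by linarith)
      rw [Real.cos_pi_div_two_sub] at this
      rw [sub_add_cancel, Real.sin_pi_div_two]
      linarith
    · rw [sub_add_cancel, Real.sin_pi]
      nlinarith
  obtain ⟨φ, hφ, e⟩ := this h0'
  exact ⟨φ, fun _ => ⟨hφ.1, hφ.2, by simp only at e; linarith⟩⟩

def phi (h : ℝ) : ℝ := (phi_exists h).choose

lemma phi_spec {h : ℝ} (hh : h ∈ Set.Ioo 0 (Real.pi / 2)) :
    Real.pi / 2 - h < phi h ∧ phi h < Real.pi - h ∧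
      phi h * Real.sin h = Real.sin (phi h) * Real.sin (phi h + h) :=
  (phi_exists h).choose_spec hh

lemma phi_mem {h : ℝ} (hh : h ∈ Set.Ioo 0 (Real.pi / 2)) : phi h ∈ Set.Ioo 0 Real.pi :=
  ⟨by linarith [(phi_spec hh).1, hh.2], by linarith [(phi_spec hh).2.1, hh.1]⟩

def Qf (φ : ℝ) : ℝ := Real.sin φ ^ 2 / (φ - Real.sin φ * Real.cos φ)

lemma Qf_deriv {φ : ℝ} (hφ : φ ∈ Set.Ioo 0 Real.pi) :
    ∃ d, d < 0 ∧ HasDerivAt Qf d φ := by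
  have hD := D_pos hφ.1
  have hs := Real.sin_pos_of_pos_of_lt_pi hφ.1 hφ.2
  have h1 := mul_cos_lt_sin hφ.1 hφ.2
  have h2 := ((Real.hasDerivAt_sin φ).pow 2).div
    ((hasDerivAt_id φ).sub ((Real.hasDerivAt_sin φ).mul (Real.hasDerivAt_cos φ))) hD.ne'
  refine ⟨_, ?_, h2⟩
  apply div_neg_of_neg_of_pos
  · simp only [Pi.pow_apply, Pi.sub_apply, id, Pi.mul_apply]
    have h3 := Real.sin_sq_add_cos_sq φ
    have : Real.sin φ * (φ * Real.cos φ - Real.sin φ) < 0 :=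
      mul_neg_of_pos_of_neg hs (by linarith)
    norm_num
    have e : 2 * Real.sin φ * Real.cos φ * (φ - Real.sin φ * Real.cos φ) -
        Real.sin φ ^ 2 * (1 - (Real.cos φ * Real.cos φ + -(Real.sin φ * Real.sin φ)))
        = 2 * (Real.sin φ * (φ * Real.cos φ - Real.sin φ)) := by
      linear_combination (-(Real.sin φ)^2) * h3
    nlinarith [e, this]
  · have : 0 < (φ - Real.sin φ * Real.cos φ) ^ 2 := by positivity
    simpa using this

lemma Qf_anti : StrictAntiOn Qf (Set.Ioo 0 Real.pi) := by
  apply strictAntiOn_of_deriv_neg (convex_Ioo _ _)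
  · intro φ hφ
    obtain ⟨d, _, hd⟩ := Qf_deriv hφ
    exact hd.continuousAt.continuousWithinAt
  · intro φ hφ
    rw [interior_Ioo] at hφ
    obtain ⟨d, h, hd⟩ := Qf_deriv hφ
    rwa [hd.deriv]

lemma Qf_phi {h : ℝ} (hh : h ∈ Set.Ioo 0 (Real.pi / 2)) : Qf (phi h) = Real.tan h := by
  have hm := phi_mem hh
  have hD := D_pos hm.1
  have e := (phi_spec hh).2.2
  have hc := Real.cos_pos_of_mem_Ioo (x := h) ⟨by linarith [hh.1, Real.pi_pos], hh.2⟩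
  rw [Qf, Real.tan_eq_sin_div_cos, div_eq_div_iff hD.ne' hc.ne']
  rw [Real.sin_add] at e
  linear_combination -e

lemma phi_smooth {h : ℝ} (hh : h ∈ Set.Ioo 0 (Real.pi / 2)) :
    ContDiffAt ℝ (⊤ : ℕ∞) phi h := by
  have hm := phi_mem hh
  obtain ⟨d, hd0, hd⟩ := Qf_deriv hm
  have hQ : ContDiffAt ℝ (⊤ : ℕ∞) Qf (phi h) := by
    apply ContDiffAt.div
    · exact (Real.contDiff_sin.pow 2).contDiffAt
    · exact (contDiff_id.sub (Real.contDiff_sin.mul Real.contDiff_cos)).contDiffAt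
    · exact (D_pos hm.1).ne'
  have hf := hd.hasFDerivAt_equiv hd0.ne
  have hn : ((⊤ : ℕ∞) : WithTop ℕ∞) ≠ 0 := by simp
  have hg := hQ.to_localInverse hf hn
  have hgi := hQ.localInverse_apply_image hf hn
  have hri : ∀ᶠ u in nhds (Qf (phi h)), Qf (hQ.localInverse hf hn u) = u :=
    (hQ.hasStrictFDerivAt' hf hn).eventually_right_inverse
  set g := hQ.localInverse hf hn
  rw [Qf_phi hh] at hg hgi hri
  have hc := Real.cos_pos_of_mem_Ioo (x := h) ⟨by linarith [hh.1, Real.pi_pos], hh.2⟩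
  have htan : ContDiffAt ℝ (⊤ : ℕ∞) Real.tan h := Real.contDiffAt_tan.2 hc.ne'
  have hcomp : ContDiffAt ℝ (⊤ : ℕ∞) (g ∘ Real.tan) h := hg.comp h htan
  refine hcomp.congr_of_eventuallyEq ?_
  have hgm : ∀ᶠ u in nhds h, (g ∘ Real.tan) u ∈ Set.Ioo 0 Real.pi := by
    apply hcomp.continuousAt.eventually_mem
    simp only [Function.comp, hgi]
    exact isOpen_Ioo.mem_nhds hm
  filter_upwards [hgm, htan.continuousAt.eventually hri, isOpen_Ioo.mem_nhds hh] with u h1 h2 h3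
  apply Qf_anti.injOn (phi_mem h3) h1
  rw [Qf_phi h3]
  exact h2.symm

lemma rho_eq {θ : ℝ} (hθ : θ ∈ Set.Ioo 0 Real.pi) :
    rho θ = 2 * Real.sin (phi (θ / 2) + θ / 2) := by
  have hh : θ / 2 ∈ Set.Ioo 0 (Real.pi / 2) := ⟨by linarith [hθ.1], by linarith [hθ.2]⟩
  have e0 : θ = 2 * (θ / 2) := by ring
  unfold rho
  rw [e0]
  rw [← e0]
  generalize θ / 2 = h at *
  subst e0
  have hm := phi_mem hh
  have e := (phi_spec hh).2.2
  have hs := Real.sin_pos_of_pos_of_lt_pi hm.1 hm.2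
  have hsh := Real.sin_pos_of_pos_of_lt_pi hh.1 (by linarith [hh.2, Real.pi_pos])
  generalize phi h = φ at *
  have e' := e
  rw [Real.sin_add] at e
  rw [dH_eq (h := h) (m := Real.cos h + Real.sin h / Real.sin φ * Real.cos φ)
    (r := Real.sin h / Real.sin φ) (φ := φ) (by positivity) hm.1 hm.2]
  · field_simp
    linear_combination e'
  · field_simp
  · ring
  · field_simp
    linear_combination e

lemma phi_hasDeriv {h : ℝ} (hh : h ∈ Set.Ioo 0 (Real.pi / 2)) :
    ∃ d, HasDerivAt phi d h ∧
      2 * Real.sin (phi h) * Real.cos (phi h + h) * d =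
        phi h * Real.cos h - Real.sin (phi h) * Real.cos (phi h + h) := by
  have hd := ((phi_smooth hh).differentiableAt (by simp)).hasDerivAt
  refine ⟨_, hd, ?_⟩
  have h1 := hd.mul (Real.hasDerivAt_sin h)
  have h2 := hd.sin.mul (hd.add (hasDerivAt_id h)).sin
  have hev : (phi * Real.sin) =ᶠ[nhds h] ((fun h => Real.sin (phi h)) *
      (fun x => Real.sin ((phi + id : ℝ → ℝ) x))) := by
    filter_upwards [isOpen_Ioo.mem_nhds hh] with u hu
    exact (phi_spec hu).2.2
  have h3 := h1.unique (h2.congr_of_eventuallyEq hev)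
  simp only [Pi.add_apply, id] at h3
  have e : Real.sin h = Real.sin (phi h + h) * Real.cos (phi h) -
      Real.cos (phi h + h) * Real.sin (phi h) := by
    rw [← Real.sin_sub]; congr 1; ring
  linear_combination -h3 + deriv phi h * e

lemma rho_hasDeriv {θ : ℝ} (hθ : θ ∈ Set.Ioo 0 Real.pi) :
    2 * Real.sin (phi (θ / 2)) * deriv rho θ =
      phi (θ / 2) * Real.cos (θ / 2) + Real.sin (phi (θ / 2)) * Real.cos (phi (θ / 2) + θ / 2) := by
  have hh : θ / 2 ∈ Set.Ioo 0 (Real.pi / 2) := ⟨by linarith [hθ.1], by linarith [hθ.2]⟩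
  obtain ⟨d, hd, e⟩ := phi_hasDeriv hh
  have hhalf : HasDerivAt (fun θ : ℝ => θ / 2) (1 / 2) θ := (hasDerivAt_id θ).div_const 2
  have h1 := (((hd.comp θ hhalf).add hhalf).sin).const_mul 2
  have hev : rho =ᶠ[nhds θ] fun θ => 2 * Real.sin (phi (θ / 2) + θ / 2) := by
    filter_upwards [isOpen_Ioo.mem_nhds hθ] with u hu using rho_eq hu
  have h2 : HasDerivAt rho _ θ := h1.congr_of_eventuallyEq hev
  rw [h2.deriv]
  simp only [Pi.add_apply, Function.comp]
  linear_combination e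

lemma rho_smooth : ContDiffOn ℝ (⊤ : ℕ∞) rho (Set.Ioo 0 Real.pi) := by
  intro θ hθ
  apply ContDiffAt.contDiffWithinAt
  have hh : θ / 2 ∈ Set.Ioo 0 (Real.pi / 2) := ⟨by linarith [hθ.1], by linarith [hθ.2]⟩
  have hev : rho =ᶠ[nhds θ] fun θ => 2 * Real.sin (phi (θ / 2) + θ / 2) := by
    filter_upwards [isOpen_Ioo.mem_nhds hθ] with u hu using rho_eq hu
  refine ContDiffAt.congr_of_eventuallyEq ?_ hev
  have hhalf : ContDiffAt ℝ (⊤ : ℕ∞) (fun θ : ℝ => θ / 2) θ := contDiffAt_id.div_const 2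
  have h1 : ContDiffAt ℝ (⊤ : ℕ∞) (fun θ : ℝ => phi (θ / 2)) θ :=
    ContDiffAt.comp (g := phi) θ (phi_smooth hh) hhalf
  exact contDiffAt_const.mul (h1.add hhalf).sin

lemma key_identity {h φ : ℝ} (e : φ * Real.sin h = Real.sin φ * Real.sin (φ + h)) :
    (φ - Real.sin φ * Real.cos φ) * (φ * Real.cos h + Real.sin φ * Real.cos (φ + h)) =
      Real.cos h * (φ ^ 2 - Real.sin φ ^ 2) := by
  rw [Real.sin_add] at e
  rw [Real.cos_add]
  have h3 := Real.sin_sq_add_cos_sq φ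
  linear_combination (-(Real.sin φ)^2) * e - (Real.cos h * Real.sin φ ^ 2) * h3

lemma sub_sin_mono {u v : ℝ} (huv : u ≤ v) : u - Real.sin u ≤ v - Real.sin v := by
  have : Monotone (fun u : ℝ => u - Real.sin u) := by
    apply monotone_of_deriv_nonneg (by fun_prop)
    intro x
    have hx : HasDerivAt (fun u : ℝ => u - Real.sin u) (1 - Real.cos x) x :=
      (hasDerivAt_id x).sub (Real.hasDerivAt_sin x)
    rw [hx.deriv]
    linarith [Real.cos_le_one x]
  exact this huv

lemma rho_bound {l : ℝ} (hl : 0 < l) (hlpi : l < Real.pi) :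
    ∃ C > (0:ℝ), ∀ θ ∈ Set.Ioo (0:ℝ) (Real.pi - l), C / Real.sqrt θ < deriv rho θ := by
  have hpi := Real.pi_pos
  have hpi4 := Real.pi_lt_four
  set k := Real.sin (l / 2) with hk
  have hkpos : 0 < k := Real.sin_pos_of_pos_of_lt_pi (by linarith) (by linarith)
  set c1 := (l / 2 - Real.sin (l / 2)) * (l / 2) with hc1
  have hc1pos : 0 < c1 := mul_pos (by linarith [Real.sin_lt (x := l / 2) (by linarith)]) (by linarith)
  set M := Real.sqrt (5 / k) with hM
  have hMpos : 0 < M := Real.sqrt_pos.2 (by positivity)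
  refine ⟨k * c1 / (20 * M), by positivity, ?_⟩
  intro θ hθ
  have hθ' : θ ∈ Set.Ioo 0 Real.pi := ⟨hθ.1, by linarith [hθ.2]⟩
  have hh : θ / 2 ∈ Set.Ioo 0 (Real.pi / 2) := ⟨by linarith [hθ'.1], by linarith [hθ'.2]⟩
  have hder := rho_hasDeriv hθ'
  have hm := phi_mem hh
  obtain ⟨hp1, hp2, e⟩ := phi_spec hh
  have hsφ := Real.sin_pos_of_pos_of_lt_pi hm.1 hm.2
  have hl2 : l / 2 ≤ phi (θ / 2) := by linarith [hθ.2]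
  have hcosk : k ≤ Real.cos (θ / 2) := by
    rw [hk, ← Real.cos_pi_div_two_sub]
    apply Real.cos_le_cos_of_nonneg_of_le_pi <;> linarith [hθ.1, hθ.2]
  generalize phi (θ / 2) = φ at *
  set ρ' := deriv rho θ
  have hkey := key_identity e
  rw [← hder] at hkey
  have hD := D_pos hm.1
  set D := φ - Real.sin φ * Real.cos φ with hDdef
  have hD5 : D ≤ 5 := by
    have := Real.neg_one_le_sin (2 * φ)
    rw [Real.sin_two_mul] at this
    linarith [hm.2]
  have hsub := sub_sin_mono hl2
  have hnum : c1 ≤ φ ^ 2 - Real.sin φ ^ 2 := by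
    have : φ ^ 2 - Real.sin φ ^ 2 = (φ - Real.sin φ) * (φ + Real.sin φ) := by ring
    rw [this, hc1]
    apply mul_le_mul hsub (by linarith) (by linarith)
    have := Real.sin_lt (x := l / 2) (by linarith)
    linarith
  have hsq : Real.sin φ ^ 2 * Real.cos (θ / 2) = Real.sin (θ / 2) * D := by
    rw [Real.sin_add] at e
    rw [hDdef]
    linear_combination -e
  have hsinθ : Real.sin (θ / 2) ≤ θ := by linarith [Real.sin_lt hh.1, hθ.1]
  have hsinθ0 := Real.sin_pos_of_pos_of_lt_pi hh.1 (by linarith [hh.2])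
  have hsle : Real.sin φ ≤ M * Real.sqrt θ := by
    rw [hM, ← Real.sqrt_mul (by positivity)]
    apply Real.le_sqrt_of_sq_le
    rw [div_mul_eq_mul_div, le_div_iff₀ hkpos]
    calc Real.sin φ ^ 2 * k ≤ Real.sin φ ^ 2 * Real.cos (θ / 2) := by gcongr
      _ = Real.sin (θ / 2) * D := hsq
      _ ≤ θ * 5 := by gcongr; exact hθ.1.le
      _ = 5 * θ := by ring
  have hsθ : 0 < Real.sqrt θ := Real.sqrt_pos.2 hθ.1
  have h1 : k * c1 ≤ D * (2 * Real.sin φ * ρ') := by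
    rw [hkey]
    exact mul_le_mul hcosk hnum hc1pos.le (hkpos.le.trans hcosk)
  have hρ : 0 < ρ' := by
    by_contra hneg
    push Not at hneg
    have : D * (2 * Real.sin φ * ρ') ≤ 0 :=
      mul_nonpos_of_nonneg_of_nonpos hD.le
        (mul_nonpos_of_nonneg_of_nonpos (by positivity) hneg)
    have : 0 < k * c1 := by positivity
    linarith
  have h2 : k * c1 ≤ 5 * (2 * (M * Real.sqrt θ) * ρ') := by
    refine h1.trans ?_
    gcongr
  rw [div_div, div_lt_iff₀ (by positivity)]
  have : 0 < M * Real.sqrt θ * ρ' := by positivity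
  nlinarith

/-- Proposition: regularity and derivative lower bound for
`ρ`. The function `ρ` is even on `[−π,π]`, smooth on `(0,π)`, and for every
`λ > 0` there is `C_λ > 0` with `ρ'(θ) > C_λ θ^{−1/2}` for all
`θ ∈ (0, π − λ)`. -/
theorem statement12 :
    (∀ θ ∈ Set.Icc (-Real.pi) Real.pi, rho (-θ) = rho θ) ∧
    ContDiffOn ℝ (⊤ : ℕ∞) rho (Set.Ioo 0 Real.pi) ∧
    ∀ l : ℝ, 0 < l → ∃ C > (0:ℝ), ∀ θ ∈ Set.Ioo (0:ℝ) (Real.pi - l),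
      C / Real.sqrt θ < deriv rho θ := by
  refine ⟨fun θ _ => rho_even θ, rho_smooth, ?_⟩
  intro l hl
  rcases lt_or_ge l Real.pi with h | h
  · exact rho_bound hl h
  · refine ⟨1, one_pos, fun θ hθ => ?_⟩
    exfalso
    have := hθ.1.trans hθ.2
    linarith
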